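/- arXiv:1102.0422 — 2 statements merged into one kernel-verified Lean document; each statement's English description precedes it below -/
import Mathlib

section
/- Suppose 1 ≤ ᾱ ≤ n-m. Then the inequality w_{α,i} < z_{α,j} holds if and only if j ≤ n - m - ᾱ + 1, for all i ∈ {1,…,m} and j ∈ {1,…,n-m}. -/
/-- If 1 ≤ ᾱ ≤ n-m then w_{α,i} < z_{α,j} iff j ≤ n-m-ᾱ+1. -/
theorem stmt9 (m n : ℕ) (hm : 1 ≤ m) (hmn : m < n) (α : ℤ)
    (rep : ℤ → ℤ) (hrep : ∀ k, rep k = (k - 1) % n + 1)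
    (hα1 : 1 ≤ rep α) (hα2 : rep α ≤ (n : ℤ) - m) :
    ∀ i j : ℕ, 1 ≤ i → i ≤ m → 1 ≤ j → j ≤ n - m →
      (rep (α + m - i) < rep (j + α + m - 1) ↔ (j : ℤ) ≤ (n : ℤ) - m - rep α + 1) := by
  intro i j hi1 hi2 hj1 hj2
  have key : ∀ k q r : ℤ, k - 1 = r + n * q → 0 ≤ r → r < n → rep k = r + 1 := by
    intro k q r h h0 h1
    rw [hrep, h, Int.add_mul_emod_self_left, Int.emod_eq_of_lt h0 h1]
  have hdiv := Int.emod_add_mul_ediv (α - 1) n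
  have ha := hrep α
  generalize rep α = a at *
  generalize hq : (α - 1) / (n : ℤ) = q at *
  have hw := key (α + m - i) q (a - 1 + m - i) (by linarith) (by omega) (by omega)
  rw [hw]
  by_cases hc : (j : ℤ) ≤ (n : ℤ) - m - a + 1
  · have hz := key (j + α + m - 1) q (j + a + m - 2) (by linarith) (by omega) (by omega)
    rw [hz]
    omega
  · have hz := key (j + α + m - 1) (q + 1) (j + a + m - 2 - n) (by linarith) (by omega) (by omega)
    rw [hz]
    omega
end

section
/- Let A = (v₁ ⋯ vₙ) be a real m×n matrix and define w₀·A = R_m · (vₙ v_{n-1} ⋯ v₁), where R_m is the m×m diagonal matrix with (1,1)-entry (-1)^{⌊m/2⌋} and all other diagonal entries 1. Then for every m-subset I of {1,…,n}, Δ_I(A) = Δ_{w₀(I)}(w₀·A), where w₀(I) = { n - i + 1 : i ∈ I }. -/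
theorem aux_prod (m : ℕ) : ∏ i ∈ Finset.range m, (-1 : ℤˣ) ^ i = (-1) ^ (m / 2) := by
  induction m with
  | zero => simp
  | succ k ih =>
    rw [Finset.prod_range_succ, ih]
    rcases Nat.even_or_odd' k with ⟨c, rfl | rfl⟩
    · have h1 : 2 * c / 2 = c := by omega
      have h2 : (2 * c + 1) / 2 = c := by omega
      rw [h1, h2, pow_mul]; simp
    · have h1 : (2 * c + 1) / 2 = c := by omega
      have h2 : (2 * c + 1 + 1) / 2 = c + 1 := by omega
      rw [h1, h2, pow_succ _ (2 * c), pow_mul, pow_succ _ c]; simp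

theorem aux_sign (m : ℕ) : Equiv.Perm.sign (Fin.revPerm : Equiv.Perm (Fin m)) = (-1) ^ (m / 2) := by
  rw [Equiv.Perm.sign_eq_prod_prod_Iio, ← aux_prod, ← Fin.prod_univ_eq_prod_range]
  refine Finset.prod_congr rfl fun j _ => ?_
  rw [Finset.prod_congr rfl (g := fun _ => (-1 : ℤˣ))]
  · simp
  · intro i hi
    rw [Finset.mem_Iio] at hi
    rw [if_neg]
    simpa using hi.le

/-- Δ_I(A) = Δ_{w₀(I)}(w₀·A): minors are preserved by column reversal together
with multiplying the first row by (-1)^⌊m/2⌋. -/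
theorem stmt17 (m n : ℕ) (hm : 1 ≤ m) (hmn : m < n)
    (A wA : Matrix (Fin m) (Fin n) ℝ)
    (hwA : ∀ i j, wA i j = (if i.val = 0 then (-1 : ℝ) ^ (m / 2) else 1) * A i j.rev)
    (I : Finset (Fin n)) (hI : I.card = m)
    (hI' : (I.image Fin.rev).card = m) :
    (A.submatrix id fun k => (I.orderIsoOfFin hI k : Fin n)).det
      = (wA.submatrix id fun k => ((I.image Fin.rev).orderIsoOfFin hI' k : Fin n)).det := by
  have key : (fun k : Fin m => (I.orderEmbOfFin hI k.rev).rev)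
      = (I.image Fin.rev).orderEmbOfFin hI' := by
    apply Finset.orderEmbOfFin_unique
    · intro k
      exact Finset.mem_image_of_mem _ (Finset.orderEmbOfFin_mem _ _ _)
    · intro a b hab
      simpa using hab
  simp only [Finset.coe_orderIsoOfFin_apply]
  have hmat : (wA.submatrix id fun k => (I.image Fin.rev).orderEmbOfFin hI' k)
      = Matrix.of fun i j => (if i.val = 0 then (-1 : ℝ) ^ (m / 2) else 1) *
        ((A.submatrix id fun k => I.orderEmbOfFin hI k).submatrix id Fin.revPerm) i j := by
    ext i j
    simp [hwA, ← key]
  rw [hmat, Matrix.det_mul_column, Matrix.det_permute', aux_sign]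
  obtain ⟨k, rfl⟩ : ∃ k, m = k + 1 := ⟨m - 1, by omega⟩
  rw [Fin.prod_univ_succ]
  simp [← mul_assoc, ← mul_pow]
end
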